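/- Composition with a graph map in weighted Sobolev spaces: Let s₁ ∈ ℕ with s₁ ≥ 3, δ₁ ∈ ℝ with δ₁ > −2, θ ∈ (0,1], κ ∈ ℝ with −1 < κ < δ₁ + 1, and ρ > 0. Then for every s′ ∈ ℕ with s′ ≤ s₁+1 and every δ′ ∈ ℝ there is a constant C, depending only on s₁, δ₁, s′, δ′, θ, κ, ρ, with the following property: for every smooth u : ℝ³ → ℝ with ‖u‖_{H_{s₁+1, δ₁−1/2}(ℝ³)} ≤ ρ and |u(x)| ≤ (θ/2)σ(x)^{−κ} for all x ∈ ℝ³, and every smooth f : Ω_θ → ℝ with ‖f‖_{H_{s′,δ′}(Ω_θ)} < ∞, the function f̃(x,t) := f(x, u(x)+t), which is well defined on Ω_{θ/2}, satisfies ‖f̃‖_{H_{s′,δ′}(Ω_{θ/2})} ≤ C ‖f‖_{H_{s′,δ′}(Ω_θ)}. -/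

import Mathlib

open MeasureTheory

/-- The boost region `Ω_θ = {(x,t) ∈ ℝ³×ℝ : |t| ≤ θσ(x)}` where `σ(x) = (1+|x|²)^{1/2}`. -/
def boostRegion (θ : ℝ) : Set (EuclideanSpace ℝ (Fin 3) × ℝ) :=
  {p | |p.2| ≤ θ * Real.sqrt (1 + ‖p.1‖ ^ 2)}

/-- The weighted Sobolev norm on a set `U ⊆ ℝ³×ℝ`, valued in `ℝ≥0∞`, with weight in the
spatial variable only. -/
noncomputable def wSobOn (s : ℕ) (δ : ℝ) (U : Set (EuclideanSpace ℝ (Fin 3) × ℝ))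
    (u : EuclideanSpace ℝ (Fin 3) × ℝ → ℝ) : ENNReal :=
  (∑ k ∈ Finset.range (s + 1),
    ∫⁻ p in U,
      ENNReal.ofReal ((1 + ‖p.1‖ ^ 2) ^ (δ + (k : ℝ)) * ‖iteratedFDeriv ℝ k u p‖ ^ 2)) ^ (1/2 : ℝ)

/-- The weighted Sobolev norm `‖u‖_{H_{s,δ}(ℝ³)}` of a spatial function, valued in `ℝ≥0∞`. -/
noncomputable def wSob (s : ℕ) (δ : ℝ) (v : EuclideanSpace ℝ (Fin 3) → ℝ) : ENNReal :=
  (∑ k ∈ Finset.range (s + 1),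
    ∫⁻ x : EuclideanSpace ℝ (Fin 3),
      ENNReal.ofReal ((1 + ‖x‖ ^ 2) ^ (δ + (k : ℝ)) * ‖iteratedFDeriv ℝ k v x‖ ^ 2)) ^ (1/2 : ℝ)

theorem norm_fderiv_fderiv {V F : Type*} [NormedAddCommGroup V] [NormedSpace ℝ V]
    [NormedAddCommGroup F] [NormedSpace ℝ F] (g : V → F) (p : V) :
    ‖fderiv ℝ (fderiv ℝ g) p‖ = ‖iteratedFDeriv ℝ 2 g p‖ := by
  rw [← norm_iteratedFDeriv_one, norm_iteratedFDeriv_fderiv]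

/-- A representation formula: the value of a `C²` function at `p` is controlled by a weighted
integral of its derivatives along the segment from `p` to `p + h`. -/
theorem norm_le_integral_segment {V F : Type*} [NormedAddCommGroup V] [NormedSpace ℝ V]
    [NormedAddCommGroup F] [NormedSpace ℝ F] [CompleteSpace F] {g : V → F}
    (hg : ContDiff ℝ 2 g) (p h : V) :
    ‖g p‖ ≤ ∫ r in (0 : ℝ)..1, r * (2 * ‖g (p + r • h)‖ + 4 * (‖h‖ * ‖fderiv ℝ g (p + r • h)‖)
      + ‖h‖ ^ 2 * ‖iteratedFDeriv ℝ 2 g (p + r • h)‖) := by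
  simp only [← norm_fderiv_fderiv]
  have hg1 : ContDiff ℝ 1 (fderiv ℝ g) := hg.fderiv_right (by norm_num)
  have hg2 : Continuous (fderiv ℝ (fderiv ℝ g)) := hg1.continuous_fderiv (by norm_num)
  have d0 : Continuous fun r : ℝ => g (p + r • h) := hg.continuous.comp (by fun_prop)
  have c1 : Continuous (fderiv ℝ g) := hg1.continuous
  have d1 : Continuous fun r : ℝ => fderiv ℝ g (p + r • h) := c1.comp (by fun_prop)
  have d2 : Continuous fun r : ℝ => fderiv ℝ (fderiv ℝ g) (p + r • h) := hg2.comp (by fun_prop)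
  have n2 : Continuous fun r : ℝ => ‖fderiv ℝ (fderiv ℝ g) (p + r • h)‖ :=
    (continuous_norm (E := V →L[ℝ] V →L[ℝ] F)).comp d2
  have hl : ∀ r : ℝ, HasDerivAt (fun r : ℝ => p + r • h) h r := fun r => by
    simpa using ((hasDerivAt_id r).smul_const h).const_add p
  have h1 : ∀ r : ℝ, HasDerivAt (fun r : ℝ => g (p + r • h)) (fderiv ℝ g (p + r • h) h) r :=
    fun r => ((hg.differentiable (by norm_num)) _).hasFDerivAt.comp_hasDerivAt r (hl r)
  have h2 : ∀ r : ℝ, HasDerivAt (fun r : ℝ => fderiv ℝ g (p + r • h) h)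
      (fderiv ℝ (fderiv ℝ g) (p + r • h) h h) r := fun r => by
    have := ((hg1.differentiable (by norm_num)) _).hasFDerivAt.comp_hasDerivAt r (hl r)
    simpa using this.clm_apply (hasDerivAt_const r h)
  have hH : ∀ r : ℝ, HasDerivAt
      (fun r : ℝ => (r * (1 - r) ^ 2) • fderiv ℝ g (p + r • h) h - (1 - r ^ 2) • g (p + r • h))
      (r • ((1 - r) ^ 2 • fderiv ℝ (fderiv ℝ g) (p + r • h) h h
        - (4 * (1 - r)) • fderiv ℝ g (p + r • h) h + (2 : ℝ) • g (p + r • h))) r := fun r => by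
    have a1 : HasDerivAt (fun r : ℝ => r * (1 - r) ^ 2) ((1 - r) ^ 2 - 2 * r * (1 - r)) r := by
      have := (hasDerivAt_id r).mul (((hasDerivAt_id r).const_sub 1).pow 2)
      exact this.congr_deriv (by simp; ring)
    have a2 : HasDerivAt (fun r : ℝ => 1 - r ^ 2) (-(2 * r)) r := by
      have := ((hasDerivAt_id r).pow 2).const_sub 1
      exact this.congr_deriv (by simp)
    exact ((a1.smul (h2 r)).sub (a2.smul (h1 r))).congr_deriv (by module)
  have hcont : Continuous fun r : ℝ => r • ((1 - r) ^ 2 • fderiv ℝ (fderiv ℝ g) (p + r • h) h h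
        - (4 * (1 - r)) • fderiv ℝ g (p + r • h) h + (2 : ℝ) • g (p + r • h)) := by fun_prop
  have key := intervalIntegral.integral_eq_sub_of_hasDerivAt (a := 0) (b := 1)
    (fun r _ => hH r) (hcont.intervalIntegrable _ _)
  have key' : g p = ∫ r in (0 : ℝ)..1, r • ((1 - r) ^ 2 •
      fderiv ℝ (fderiv ℝ g) (p + r • h) h h
        - (4 * (1 - r)) • fderiv ℝ g (p + r • h) h + (2 : ℝ) • g (p + r • h)) := by
    rw [key]; simp
  rw [key']
  refine (intervalIntegral.norm_integral_le_integral_norm zero_le_one).trans ?_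
  refine intervalIntegral.integral_mono_on zero_le_one (hcont.norm.intervalIntegrable _ _)
    (Continuous.intervalIntegrable (by fun_prop) _ _) fun r hr => ?_
  obtain ⟨hr0, hr1⟩ := hr
  rw [norm_smul, Real.norm_of_nonneg hr0]
  gcongr
  have e2 : ‖fderiv ℝ (fderiv ℝ g) (p + r • h) h h‖
      ≤ ‖h‖ ^ 2 * ‖fderiv ℝ (fderiv ℝ g) (p + r • h)‖ :=
    (ContinuousLinearMap.le_opNorm₂ _ _ _).trans_eq (by ring)
  have e1 : ‖fderiv ℝ g (p + r • h) h‖ ≤ ‖h‖ * ‖fderiv ℝ g (p + r • h)‖ :=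
    (ContinuousLinearMap.le_opNorm _ _).trans_eq (by ring)
  have b2 : (1 - r) ^ 2 ≤ 1 := by nlinarith
  have b1 : |4 * (1 - r)| ≤ 4 := by rw [abs_of_nonneg (by linarith)]; linarith
  refine (norm_add_le _ _).trans ((add_le_add_left (norm_sub_le _ _) _).trans ?_)
  rw [norm_smul, norm_smul, norm_smul, Real.norm_eq_abs, Real.norm_eq_abs, Real.norm_eq_abs,
    abs_of_nonneg (sq_nonneg (1 - r)), abs_of_nonneg (zero_le_two (α := ℝ))]
  have f2 := mul_le_mul b2 e2 (norm_nonneg _) zero_le_one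
  have f1 := mul_le_mul b1 e1 (norm_nonneg _) (by norm_num)
  linarith

theorem lintegral_Ioc_rpow_neg_half :
    ∫⁻ r in Set.Ioc (0 : ℝ) 1, ENNReal.ofReal (r ^ (-(1 / 2) : ℝ)) = 2 := by
  rw [← ofReal_integral_eq_lintegral_ofReal]
  · rw [← intervalIntegral.integral_of_le zero_le_one, integral_rpow (by norm_num)]
    norm_num
  · have := intervalIntegral.intervalIntegrable_rpow' (a := 0) (b := 1)
      (r := (-(1 / 2) : ℝ)) (by norm_num)
    rwa [intervalIntegrable_iff_integrableOn_Ioc_of_le zero_le_one] at this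
  · filter_upwards [ae_restrict_mem measurableSet_Ioc] with r hr
    exact Real.rpow_nonneg hr.1.le _

/-- Weighted Cauchy–Schwarz inequality on the unit interval. -/
theorem ofReal_integral_mul_sq_le {w : ℝ → ℝ} (hw : Continuous w) (hw0 : ∀ r, 0 ≤ w r) :
    ENNReal.ofReal ((∫ r in (0 : ℝ)..1, r * w r) ^ 2) ≤
      2 * ∫⁻ r in Set.Ioc (0 : ℝ) 1, ENNReal.ofReal (r ^ (5 / 2 : ℝ)) *
        ENNReal.ofReal (w r ^ 2) := by
  have hnn : 0 ≤ ∫ r in (0 : ℝ)..1, r * w r :=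
    intervalIntegral.integral_nonneg zero_le_one fun r hr => mul_nonneg hr.1 (hw0 r)
  have hcs := ENNReal.lintegral_mul_le_Lp_mul_Lq (volume.restrict (Set.Ioc (0 : ℝ) 1))
    Real.HolderConjugate.two_two
    (f := fun r => ENNReal.ofReal (r ^ (-(1 / 4) : ℝ)))
    (g := fun r => ENNReal.ofReal (r ^ (5 / 4 : ℝ) * w r)) (by fun_prop) (by fun_prop)
  have e0 : ∫⁻ r in Set.Ioc (0 : ℝ) 1, ((fun r => ENNReal.ofReal (r ^ (-(1 / 4) : ℝ))) *
      fun r => ENNReal.ofReal (r ^ (5 / 4 : ℝ) * w r)) r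
      = ENNReal.ofReal (∫ r in (0 : ℝ)..1, r * w r) := by
    rw [intervalIntegral.integral_of_le zero_le_one, ofReal_integral_eq_lintegral_ofReal]
    · refine setLIntegral_congr_fun measurableSet_Ioc fun r hr => ?_
      have hr0 := hr.1
      simp only [Pi.mul_apply]
      rw [← ENNReal.ofReal_mul (by positivity), ← mul_assoc, ← Real.rpow_add hr0]
      norm_num
    · have : IntervalIntegrable (fun r => r * w r) volume 0 1 :=
        Continuous.intervalIntegrable (by fun_prop) _ _
      rwa [intervalIntegrable_iff_integrableOn_Ioc_of_le zero_le_one] at this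
    · filter_upwards [ae_restrict_mem measurableSet_Ioc] with r hr
      exact mul_nonneg hr.1.le (hw0 r)
  have e1 : ∫⁻ r in Set.Ioc (0 : ℝ) 1, ENNReal.ofReal (r ^ (-(1 / 4) : ℝ)) ^ (2 : ℝ) = 2 := by
    rw [← lintegral_Ioc_rpow_neg_half]
    refine setLIntegral_congr_fun measurableSet_Ioc fun r hr => ?_
    have hr0 := hr.1
    rw [ENNReal.ofReal_rpow_of_pos (by positivity), ← Real.rpow_mul hr0.le]
    norm_num
  have e2 : ∫⁻ r in Set.Ioc (0 : ℝ) 1, ENNReal.ofReal (r ^ (5 / 4 : ℝ) * w r) ^ (2 : ℝ)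
      = ∫⁻ r in Set.Ioc (0 : ℝ) 1, ENNReal.ofReal (r ^ (5 / 2 : ℝ)) *
        ENNReal.ofReal (w r ^ 2) := by
    refine setLIntegral_congr_fun measurableSet_Ioc fun r hr => ?_
    have hr0 := hr.1
    have := hw0 r
    rw [ENNReal.ofReal_rpow_of_nonneg (by positivity) (by norm_num), ← ENNReal.ofReal_mul
      (by positivity), Real.mul_rpow (by positivity) this, ← Real.rpow_mul hr0.le]
    norm_num
  rw [e0, e1, e2] at hcs
  rw [ENNReal.ofReal_pow hnn]
  refine (pow_le_pow_left' hcs 2).trans_eq ?_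
  rw [mul_pow, ← ENNReal.rpow_natCast, ← ENNReal.rpow_natCast, ← ENNReal.rpow_mul,
    ← ENNReal.rpow_mul]
  norm_num

/-- Three-dimensional Euclidean space. -/
abbrev Space := EuclideanSpace ℝ (Fin 3)

/-- The points at least as far from the origin as `x`, with a comparable weight. -/
def outerShell (x : Space) : Set Space :=
  {y | ‖x‖ ≤ ‖y‖ ∧ 1 + ‖y‖ ^ 2 ≤ 5 * (1 + ‖x‖ ^ 2)}

theorem measurableSet_outerShell (x : Space) : MeasurableSet (outerShell x) := by
  rw [outerShell, Set.ofPred_and]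
  exact (measurableSet_le (f := fun _ => ‖x‖) (g := fun y : Space => ‖y‖) (by fun_prop)
    (by fun_prop)).inter (measurableSet_le (f := fun y : Space => 1 + ‖y‖ ^ 2)
      (g := fun _ => 5 * (1 + ‖x‖ ^ 2)) (by fun_prop) (by fun_prop))

/-- The constant in the three-dimensional averaging estimate on outer shells. -/
noncomputable def shellConst : ENNReal :=
  4 * (volume (Metric.closedBall (0 : Space) 1))⁻¹

theorem shellConst_ne_top : shellConst ≠ ⊤ :=
  ENNReal.mul_ne_top (by norm_num)
    (ENNReal.inv_ne_top.2 (Metric.measure_closedBall_pos volume _ one_pos).ne')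

theorem lintegral_comp_add_smul (x : Space) {s : ℝ} (hs : 0 < s) {W : Space → ENNReal}
    (hW : Measurable W) :
    ∫⁻ z, W (x + s • z) = ENNReal.ofReal ((s ^ 3)⁻¹) * ∫⁻ y, W y := by
  have h1 : ∫⁻ z, W (x + s • z) = ∫⁻ y, W (x + y) ∂(Measure.map (s • ·) volume) :=
    (lintegral_map (f := fun y => W (x + y)) (by fun_prop) (by fun_prop)).symm
  rw [h1, Measure.map_addHaar_smul _ hs.ne', lintegral_smul_measure,
    lintegral_add_left_eq_self W x, abs_of_pos (by positivity)]
  simp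

theorem add_smul_mem_outerShell {x z : Space} (hz : ‖z‖ ≤ 1) (hxz : 0 ≤ inner ℝ x z) {r : ℝ}
    (hr0 : 0 ≤ r) (hr1 : r ≤ 1) : x + (r * √(1 + ‖x‖ ^ 2)) • z ∈ outerShell x := by
  set s := r * √(1 + ‖x‖ ^ 2) with hs
  have hs0 : 0 ≤ s := by positivity
  have hs2 : s ^ 2 ≤ 1 + ‖x‖ ^ 2 := by
    rw [hs, mul_pow, Real.sq_sqrt (by positivity)]
    exact mul_le_of_le_one_left (by positivity) (pow_le_one₀ hr0 hr1)
  have hexp : ‖x + s • z‖ ^ 2 = ‖x‖ ^ 2 + 2 * (s * inner ℝ x z) + (s * ‖z‖) ^ 2 := by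
    rw [norm_add_sq_real, inner_smul_right, norm_smul, Real.norm_of_nonneg hs0]
  have hsz : (s * ‖z‖) ^ 2 ≤ 1 + ‖x‖ ^ 2 :=
    (pow_le_pow_left₀ (by positivity) (mul_le_of_le_one_right hs0 hz) 2).trans hs2
  have hin : s * inner ℝ x z ≤ ‖x‖ * (s * ‖z‖) :=
    (mul_le_mul_of_nonneg_left (real_inner_le_norm x z) hs0).trans_eq (by ring)
  have hin0 : 0 ≤ s * inner ℝ x z := mul_nonneg hs0 hxz
  refine ⟨?_, ?_⟩
  · refine le_of_sq_le_sq ?_ (norm_nonneg _)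
    nlinarith [sq_nonneg (s * ‖z‖)]
  · nlinarith [sq_nonneg (‖x‖ - s * ‖z‖)]

theorem volume_closedBall_le_two_mul_half (x : Space) :
    volume (Metric.closedBall (0 : Space) 1) ≤
      2 * volume {z : Space | ‖z‖ ≤ 1 ∧ 0 ≤ inner ℝ x z} := by
  have hsub : Metric.closedBall (0 : Space) 1 ⊆ {z : Space | ‖z‖ ≤ 1 ∧ 0 ≤ inner ℝ x z} ∪
      (fun z => -z) ⁻¹' {z : Space | ‖z‖ ≤ 1 ∧ 0 ≤ inner ℝ x z} := by
    intro z hz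
    have hz' : ‖z‖ ≤ 1 := by simpa using hz
    rcases le_total 0 (inner ℝ x z) with h | h
    · exact Or.inl ⟨hz', h⟩
    · exact Or.inr ⟨by simpa using hz', by simpa using h⟩
  refine (measure_mono hsub).trans ((measure_union_le _ _).trans_eq ?_)
  rw [Measure.measure_preimage_neg, two_mul]

/-- Averaging over directions turns a bound by weighted integrals along all outgoing segments
into a bound by an integral over the outer shell. -/
theorem le_lintegral_outerShell (x : Space) {W : Space → ENNReal} (hW : Measurable W)
    {X : ENNReal}
    (h : ∀ z : Space, ‖z‖ ≤ 1 → 0 ≤ inner ℝ x z → X ≤ ∫⁻ r in Set.Ioc (0 : ℝ) 1,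
      ENNReal.ofReal (r ^ (5 / 2 : ℝ)) * W (x + (r * √(1 + ‖x‖ ^ 2)) • z)) :
    X ≤ shellConst * (ENNReal.ofReal ((√(1 + ‖x‖ ^ 2) ^ 3)⁻¹) * ∫⁻ y in outerShell x, W y) := by
  set R := √(1 + ‖x‖ ^ 2) with hR
  have hR0 : 0 < R := by positivity
  set H := {z : Space | ‖z‖ ≤ 1 ∧ 0 ≤ inner ℝ x z} with hH
  have hHm : MeasurableSet H :=
    (measurableSet_le (f := fun z : Space => ‖z‖) (g := fun _ => 1) (by fun_prop)
      (by fun_prop)).inter (measurableSet_le (f := fun _ => 0) (g := fun z : Space => inner ℝ x z)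
        (by fun_prop) (by fun_prop))
  set B := volume (Metric.closedBall (0 : Space) 1) with hB
  have hB0 : B ≠ 0 := (Metric.measure_closedBall_pos volume _ one_pos).ne'
  have hBt : B ≠ ⊤ := measure_closedBall_lt_top.ne
  set J := ∫⁻ y in outerShell x, W y with hJ
  have hinner : ∀ r ∈ Set.Ioc (0 : ℝ) 1,
      ENNReal.ofReal (r ^ (5 / 2 : ℝ)) * ∫⁻ z in H, W (x + (r * R) • z) ≤
        ENNReal.ofReal (r ^ (-(1 / 2) : ℝ)) * (ENNReal.ofReal ((R ^ 3)⁻¹) * J) := by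
    intro r hr
    have hr0 := hr.1
    have h1 : ∫⁻ z in H, W (x + (r * R) • z) ≤ ENNReal.ofReal (((r * R) ^ 3)⁻¹) * J := by
      rw [hJ, ← lintegral_indicator (measurableSet_outerShell x),
        ← lintegral_comp_add_smul x (by positivity) (hW.indicator (measurableSet_outerShell x)),
        ← lintegral_indicator hHm]
      refine lintegral_mono fun z => ?_
      by_cases hz : z ∈ H
      swap
      · simp [hz]
      rw [Set.indicator_of_mem hz]
      rw [Set.indicator_of_mem (add_smul_mem_outerShell hz.1 hz.2 hr.1.le hr.2)]
    refine (mul_le_mul_right h1 _).trans_eq ?_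
    rw [← mul_assoc, ← mul_assoc, ← ENNReal.ofReal_mul (by positivity),
      ← ENNReal.ofReal_mul (by positivity), mul_pow, mul_inv, ← mul_assoc]
    congr 3
    rw [← Real.rpow_natCast, ← Real.rpow_neg hr0.le, ← Real.rpow_add hr0]
    norm_num
  have hmain : X * volume H ≤ 2 * (ENNReal.ofReal ((R ^ 3)⁻¹) * J) := by
    calc X * volume H = ∫⁻ _ in H, X := by rw [setLIntegral_const]
      _ ≤ ∫⁻ z in H, ∫⁻ r in Set.Ioc (0 : ℝ) 1,
          ENNReal.ofReal (r ^ (5 / 2 : ℝ)) * W (x + (r * R) • z) :=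
        setLIntegral_mono' hHm fun z hz => h z hz.1 hz.2
      _ = ∫⁻ r in Set.Ioc (0 : ℝ) 1, ∫⁻ z in H,
          ENNReal.ofReal (r ^ (5 / 2 : ℝ)) * W (x + (r * R) • z) :=
        lintegral_lintegral_swap (by
          refine Measurable.aemeasurable ?_
          refine Measurable.mul (by fun_prop) (hW.comp (by fun_prop)))
      _ = ∫⁻ r in Set.Ioc (0 : ℝ) 1, ENNReal.ofReal (r ^ (5 / 2 : ℝ)) *
          ∫⁻ z in H, W (x + (r * R) • z) := by
        refine lintegral_congr fun r => lintegral_const_mul _ (by fun_prop)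
      _ ≤ ∫⁻ r in Set.Ioc (0 : ℝ) 1,
          ENNReal.ofReal (r ^ (-(1 / 2) : ℝ)) * (ENNReal.ofReal ((R ^ 3)⁻¹) * J) :=
        setLIntegral_mono' measurableSet_Ioc hinner
      _ = 2 * (ENNReal.ofReal ((R ^ 3)⁻¹) * J) := by
        rw [lintegral_mul_const _ (by fun_prop), lintegral_Ioc_rpow_neg_half]
  have hXB : X * B ≤ 4 * (ENNReal.ofReal ((R ^ 3)⁻¹) * J) := by
    calc X * B ≤ X * (2 * volume H) := mul_le_mul_right (volume_closedBall_le_two_mul_half x) _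
      _ = 2 * (X * volume H) := by ring
      _ ≤ 2 * (2 * (ENNReal.ofReal ((R ^ 3)⁻¹) * J)) := mul_le_mul_right hmain _
      _ = 4 * (ENNReal.ofReal ((R ^ 3)⁻¹) * J) := by ring
  calc X = X * B * B⁻¹ := by rw [mul_assoc, ENNReal.mul_inv_cancel hB0 hBt, mul_one]
    _ ≤ 4 * (ENNReal.ofReal ((R ^ 3)⁻¹) * J) * B⁻¹ := mul_le_mul_left hXB _
    _ = _ := by rw [shellConst]; ring

/-- A Sobolev inequality on outer shells: `H²` controls point values in three dimensions. -/
theorem ofReal_norm_sq_le_lintegral_outerShell {V F : Type*} [NormedAddCommGroup V]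
    [NormedSpace ℝ V] [NormedAddCommGroup F] [NormedSpace ℝ F] [CompleteSpace F] {g : V → F}
    (hg : ContDiff ℝ 2 g) (A : Space →L[ℝ] V) (hA : ‖A‖ ≤ 1) (b : V) (x : Space) :
    ENNReal.ofReal (‖g (A x + b)‖ ^ 2) ≤
      42 * shellConst * (ENNReal.ofReal ((√(1 + ‖x‖ ^ 2) ^ 3)⁻¹) * ∫⁻ y in outerShell x,
        ENNReal.ofReal (‖g (A y + b)‖ ^ 2 + (1 + ‖x‖ ^ 2) * ‖fderiv ℝ g (A y + b)‖ ^ 2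
          + (1 + ‖x‖ ^ 2) ^ 2 * ‖iteratedFDeriv ℝ 2 g (A y + b)‖ ^ 2)) := by
  have hg1 : ContDiff ℝ 1 (fderiv ℝ g) := hg.fderiv_right (by norm_num)
  have n0 : Continuous fun p => ‖g p‖ := hg.continuous.norm
  have n1 : Continuous fun p => ‖fderiv ℝ g p‖ := hg1.continuous.norm
  have n2 : Continuous fun p => ‖iteratedFDeriv ℝ 2 g p‖ :=
    (hg.continuous_iteratedFDeriv le_rfl).norm
  set R := √(1 + ‖x‖ ^ 2) with hR
  have hR0 : 0 ≤ R := Real.sqrt_nonneg _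
  have hR2 : R ^ 2 = 1 + ‖x‖ ^ 2 := Real.sq_sqrt (by positivity)
  set W : Space → ENNReal := fun y =>
    ENNReal.ofReal (‖g (A y + b)‖ ^ 2 + (1 + ‖x‖ ^ 2) * ‖fderiv ℝ g (A y + b)‖ ^ 2
          + (1 + ‖x‖ ^ 2) ^ 2 * ‖iteratedFDeriv ℝ 2 g (A y + b)‖ ^ 2) with hW
  have hWm : Measurable W := by
    refine ENNReal.measurable_ofReal.comp (Continuous.measurable ?_)
    have hAb : Continuous fun y : Space => A y + b := by fun_prop
    have i0 := n0.comp hAb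
    have i1 := n1.comp hAb
    have i2 := n2.comp hAb
    exact ((i0.pow 2).add (continuous_const.mul (i1.pow 2))).add
      (continuous_const.mul (i2.pow 2))
  have key : ENNReal.ofReal (‖g (A x + b)‖ ^ 2) ≤
      shellConst * (ENNReal.ofReal ((R ^ 3)⁻¹) * ∫⁻ y in outerShell x, 42 * W y) := by
    refine le_lintegral_outerShell x (hWm.const_mul _) fun z hz _ => ?_
    have hh : ‖R • A z‖ ≤ R := by
      rw [norm_smul, Real.norm_of_nonneg hR0]
      exact mul_le_of_le_one_right hR0 ((A.le_opNorm z).trans (mul_le_one₀ hA (norm_nonneg _) hz))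
    have h1 := norm_le_integral_segment hg (A x + b) (R • A z)
    set w : ℝ → ℝ := fun r => 2 * ‖g (A x + b + r • R • A z)‖
      + 4 * (‖R • A z‖ * ‖fderiv ℝ g (A x + b + r • R • A z)‖)
      + ‖R • A z‖ ^ 2 * ‖iteratedFDeriv ℝ 2 g (A x + b + r • R • A z)‖ with hw
    have hwc : Continuous w := by
      have j : Continuous fun r : ℝ => A x + b + r • R • A z := by fun_prop
      exact ((continuous_const.mul (n0.comp j)).add
        (continuous_const.mul (continuous_const.mul (n1.comp j)))).add
        (continuous_const.mul (n2.comp j))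
    have h2 := ofReal_integral_mul_sq_le hwc (fun r => by positivity)
    refine (ENNReal.ofReal_le_ofReal (pow_le_pow_left₀ (norm_nonneg _) h1 2)).trans
      (h2.trans ?_)
    rw [← lintegral_const_mul' _ _ (by norm_num)]
    refine lintegral_mono fun r => ?_
    have hp : A x + b + r • R • A z = A (x + (r * R) • z) + b := by
      rw [map_add, map_smul, mul_smul]; abel
    have hwle : w r ^ 2 ≤ 21 * (‖g (A (x + (r * R) • z) + b)‖ ^ 2
        + (1 + ‖x‖ ^ 2) * ‖fderiv ℝ g (A (x + (r * R) • z) + b)‖ ^ 2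
        + (1 + ‖x‖ ^ 2) ^ 2 * ‖iteratedFDeriv ℝ 2 g (A (x + (r * R) • z) + b)‖ ^ 2) := by
      simp only [hw]
      rw [hp, ← hR2]
      generalize ‖g (A (x + (r * R) • z) + b)‖ = a0
      have k1 := mul_le_mul_of_nonneg_right hh
        (norm_nonneg (fderiv ℝ g (A (x + (r * R) • z) + b)))
      have k2 := mul_le_mul_of_nonneg_right (pow_le_pow_left₀ (norm_nonneg _) hh 2)
        (norm_nonneg (iteratedFDeriv ℝ 2 g (A (x + (r * R) • z) + b)))
      have l1 : (‖R • A z‖ * ‖fderiv ℝ g (A (x + (r * R) • z) + b)‖) ^ 2 ≤ _ :=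
        pow_le_pow_left₀ (by positivity) k1 2
      have l2 : (‖R • A z‖ ^ 2 * ‖iteratedFDeriv ℝ 2 g (A (x + (r * R) • z) + b)‖) ^ 2 ≤ _ :=
        pow_le_pow_left₀ (by positivity) k2 2
      rw [mul_pow R] at l1
      rw [mul_pow (R ^ 2)] at l2
      generalize ‖R • A z‖ * ‖fderiv ℝ g (A (x + (r * R) • z) + b)‖ = a1 at *
      generalize ‖R • A z‖ ^ 2 * ‖iteratedFDeriv ℝ 2 g (A (x + (r * R) • z) + b)‖ = a2 at *
      nlinarith [sq_nonneg (4 * a0 - 2 * a1), sq_nonneg (a0 - 2 * a2), sq_nonneg (a1 - 4 * a2)]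
    calc 2 * (ENNReal.ofReal (r ^ (5 / 2 : ℝ)) * ENNReal.ofReal (w r ^ 2))
        ≤ 2 * (ENNReal.ofReal (r ^ (5 / 2 : ℝ)) * (21 * W (x + (r * R) • z))) := by
          refine mul_le_mul_right (mul_le_mul_right
            ((ENNReal.ofReal_le_ofReal hwle).trans_eq ?_) _) _
          rw [ENNReal.ofReal_mul (by norm_num), hW]
          norm_num
      _ = ENNReal.ofReal (r ^ (5 / 2 : ℝ)) * (42 * W (x + (r * R) • z)) := by ring
  refine key.trans_eq ?_
  rw [lintegral_const_mul _ hWm]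
  ring

theorem rpow_le_five_rpow_mul_rpow {q y a b : ℝ} (hq : 1 ≤ q) (hqy : q ≤ y) (hy : y ≤ 5 * q)
    (hab : |a| ≤ b) : q ^ a ≤ 5 ^ b * y ^ a := by
  have hq0 : 0 < q := by linarith
  have hy0 : 0 < y := by linarith
  rcases le_or_gt 0 a with ha | ha
  · have h1 : (1 : ℝ) ≤ 5 ^ b :=
      Real.one_le_rpow (by norm_num) ((abs_nonneg a).trans hab)
    exact (Real.rpow_le_rpow hq0.le hqy ha).trans (le_mul_of_one_le_left (by positivity) h1)
  · have h1 : (5 * q) ^ a ≤ y ^ a := Real.rpow_le_rpow_of_nonpos hy0 hy ha.le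
    have h2 : q ^ a = 5 ^ (-a) * (5 * q) ^ a := by
      rw [Real.mul_rpow (by norm_num) hq0.le, ← mul_assoc, ← Real.rpow_add (by norm_num)]
      simp
    rw [h2]
    have h3 : (5 : ℝ) ^ (-a) ≤ 5 ^ b :=
      Real.rpow_le_rpow_of_exponent_le (by norm_num) ((neg_le_abs a).trans hab)
    exact mul_le_mul h3 h1 (by positivity) (by positivity)

/-- The constant of the weighted Sobolev inequality for derivatives up to order `n`. -/
noncomputable def sobolevConst (δ : ℝ) (n : ℕ) : ENNReal :=
  42 * shellConst * ENNReal.ofReal (5 ^ (|δ| + n + 2))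

theorem sobolevConst_ne_top (δ : ℝ) (n : ℕ) : sobolevConst δ n ≠ ⊤ :=
  ENNReal.mul_ne_top (ENNReal.mul_ne_top (by norm_num) shellConst_ne_top) ENNReal.ofReal_ne_top

theorem norm_iteratedFDeriv_two_iteratedFDeriv {V F : Type*} [NormedAddCommGroup V]
    [NormedSpace ℝ V] [NormedAddCommGroup F] [NormedSpace ℝ F] (f : V → F) (m : ℕ) (p : V) :
    ‖iteratedFDeriv ℝ 2 (iteratedFDeriv ℝ m f) p‖ = ‖iteratedFDeriv ℝ (m + 2) f p‖ := by
  rw [← norm_iteratedFDeriv_fderiv, fderiv_iteratedFDeriv,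
    LinearIsometryEquiv.norm_iteratedFDeriv_comp_left, norm_iteratedFDeriv_one,
    norm_fderiv_iteratedFDeriv]

/-- Weighted Sobolev inequality on outer shells for iterated derivatives. -/
theorem weighted_iteratedFDeriv_sq_le {V : Type*} [NormedAddCommGroup V] [NormedSpace ℝ V]
    {f : V → ℝ} (hf : ContDiff ℝ (⊤ : ℕ∞) f) (A : Space →L[ℝ] V) (hA : ‖A‖ ≤ 1) (b : V)
    (x : Space) (δ : ℝ) {m n : ℕ} (hmn : m ≤ n) :
    ENNReal.ofReal ((1 + ‖x‖ ^ 2) ^ (δ + (m : ℝ)) * ‖iteratedFDeriv ℝ m f (A x + b)‖ ^ 2) ≤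
      sobolevConst δ n * (ENNReal.ofReal ((√(1 + ‖x‖ ^ 2) ^ 3)⁻¹) *
        ∑ l ∈ Finset.range 3, ∫⁻ y in outerShell x, ENNReal.ofReal
          ((1 + ‖y‖ ^ 2) ^ (δ + ((m + l : ℕ) : ℝ)) *
            ‖iteratedFDeriv ℝ (m + l) f (A y + b)‖ ^ 2)) := by
  set q := 1 + ‖x‖ ^ 2 with hq
  have hq1 : 1 ≤ q := by rw [hq]; nlinarith [sq_nonneg ‖x‖]
  have hq0 : 0 < q := by linarith
  have hc : ∀ k : ℕ, Continuous fun y : Space => iteratedFDeriv ℝ k f (A y + b) := fun k =>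
    (hf.continuous_iteratedFDeriv (by exact_mod_cast le_top)).comp (by fun_prop)
  have hg : ContDiff ℝ 2 (iteratedFDeriv ℝ m f) :=
    (hf.of_le (WithTop.coe_le_coe.2 le_top : ((2 + m : ℕ) : WithTop ℕ∞) ≤ _)).iteratedFDeriv_right
      (by simp)
  have h1 := ofReal_norm_sq_le_lintegral_outerShell hg A hA b x
  rw [← hq] at h1
  rw [ENNReal.ofReal_mul (by positivity)]
  refine (mul_le_mul_right h1 _).trans ?_
  have hmeas : ∀ l : ℕ, Measurable fun y : Space => ENNReal.ofReal
      ((1 + ‖y‖ ^ 2) ^ (δ + ((m + l : ℕ) : ℝ)) *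
        ‖iteratedFDeriv ℝ (m + l) f (A y + b)‖ ^ 2) := fun l => by
    have := (hc (m + l)).norm.measurable
    fun_prop
  rw [← lintegral_finsetSum _ fun l _ => hmeas l]
  rw [sobolevConst]
  have hshell : ENNReal.ofReal (q ^ (δ + (m : ℝ))) * ∫⁻ y in outerShell x,
        ENNReal.ofReal (‖iteratedFDeriv ℝ m f (A y + b)‖ ^ 2
          + q * ‖fderiv ℝ (iteratedFDeriv ℝ m f) (A y + b)‖ ^ 2
          + q ^ 2 * ‖iteratedFDeriv ℝ 2 (iteratedFDeriv ℝ m f) (A y + b)‖ ^ 2) ≤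
      ENNReal.ofReal (5 ^ (|δ| + n + 2)) * ∫⁻ y in outerShell x,
        ∑ l ∈ Finset.range 3, ENNReal.ofReal ((1 + ‖y‖ ^ 2) ^ (δ + ((m + l : ℕ) : ℝ)) *
            ‖iteratedFDeriv ℝ (m + l) f (A y + b)‖ ^ 2) := by
    rw [← lintegral_const_mul' _ _ ENNReal.ofReal_ne_top,
      ← lintegral_const_mul' _ _ ENNReal.ofReal_ne_top]
    refine setLIntegral_mono' (measurableSet_outerShell x) fun y hy => ?_
    have hqy : q ≤ 1 + ‖y‖ ^ 2 := by
      have := pow_le_pow_left₀ (norm_nonneg x) hy.1 2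
      linarith
    rw [norm_fderiv_iteratedFDeriv, norm_iteratedFDeriv_two_iteratedFDeriv,
      ← ENNReal.ofReal_sum_of_nonneg fun l _ => by positivity,
      ← ENNReal.ofReal_mul (by positivity), ← ENNReal.ofReal_mul (by positivity)]
    refine ENNReal.ofReal_le_ofReal ?_
    have hw : ∀ l : ℕ, l ≤ 2 → q ^ (δ + (m : ℝ)) * q ^ l ≤
        5 ^ (|δ| + n + 2) * (1 + ‖y‖ ^ 2) ^ (δ + ((m + l : ℕ) : ℝ)) := fun l hl => by
      rw [← Real.rpow_natCast, ← Real.rpow_add hq0, Nat.cast_add, ← add_assoc]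
      refine rpow_le_five_rpow_mul_rpow hq1 hqy hy.2 ?_
      have hm : (m : ℝ) ≤ n := by exact_mod_cast hmn
      have hl' : (l : ℝ) ≤ 2 := by exact_mod_cast hl
      have e1 := abs_add_le (δ + m) (l : ℝ)
      have e2 := abs_add_le δ (m : ℝ)
      rw [abs_of_nonneg (Nat.cast_nonneg (α := ℝ) l)] at e1
      rw [abs_of_nonneg (Nat.cast_nonneg (α := ℝ) m)] at e2
      linarith
    rw [Finset.mul_sum, mul_add, mul_add]
    simp only [Finset.sum_range_succ, Finset.sum_range_zero, zero_add]
    have w0 := mul_le_mul_of_nonneg_right (hw 0 (by norm_num))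
      (sq_nonneg ‖iteratedFDeriv ℝ (m + 0) f (A y + b)‖)
    have w1 := mul_le_mul_of_nonneg_right (hw 1 (by norm_num))
      (sq_nonneg ‖iteratedFDeriv ℝ (m + 1) f (A y + b)‖)
    have w2 := mul_le_mul_of_nonneg_right (hw 2 (by norm_num))
      (sq_nonneg ‖iteratedFDeriv ℝ (m + 2) f (A y + b)‖)
    rw [mul_assoc, mul_assoc] at w0 w1 w2
    refine add_le_add (add_le_add ?_ ?_) ?_
    · simpa using w0
    · simpa using w1
    · exact w2
  calc _ = 42 * shellConst * (ENNReal.ofReal ((√q ^ 3)⁻¹) * (ENNReal.ofReal (q ^ (δ + (m : ℝ))) *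
        ∫⁻ y in outerShell x, ENNReal.ofReal (‖iteratedFDeriv ℝ m f (A y + b)‖ ^ 2
          + q * ‖fderiv ℝ (iteratedFDeriv ℝ m f) (A y + b)‖ ^ 2
          + q ^ 2 * ‖iteratedFDeriv ℝ 2 (iteratedFDeriv ℝ m f) (A y + b)‖ ^ 2))) := by ring
    _ ≤ _ := mul_le_mul_right (mul_le_mul_right hshell _) _
    _ = _ := by ring

/-- The shear of `ℝ³ × ℝ` along the graph of `u`. -/
def graphShear (u : Space → ℝ) (p : Space × ℝ) : Space × ℝ := (p.1, u p.1 + p.2)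

theorem contDiff_graphShear {u : Space → ℝ} {n : WithTop ℕ∞} (hu : ContDiff ℝ n u) :
    ContDiff ℝ n (graphShear u) :=
  contDiff_fst.prodMk ((hu.comp contDiff_fst).add contDiff_snd)

theorem norm_iteratedFDeriv_graphShear_le {u : Space → ℝ} (hu : ContDiff ℝ (⊤ : ℕ∞) u) (i : ℕ)
    (p : Space × ℝ) :
    ‖iteratedFDeriv ℝ i (graphShear u) p‖ ≤
      ‖iteratedFDeriv ℝ i (fun p : Space × ℝ => p) p‖ + ‖iteratedFDeriv ℝ i u p.1‖ := by
  have hi : ((i : ℕ) : WithTop ℕ∞) ≤ ((⊤ : ℕ∞) : WithTop ℕ∞) := WithTop.coe_le_coe.2 le_top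
  have hu' : ContDiff ℝ i u := hu.of_le hi
  have hfst : ContDiff ℝ i (u ∘ ContinuousLinearMap.fst ℝ Space ℝ) :=
    hu'.comp (ContinuousLinearMap.contDiff _)
  have heq : graphShear u = (fun p : Space × ℝ => p) +
      (ContinuousLinearMap.inr ℝ Space ℝ) ∘ (u ∘ ContinuousLinearMap.fst ℝ Space ℝ) := by
    funext p
    simp [graphShear, Prod.ext_iff, add_comm]
  rw [heq, iteratedFDeriv_add_apply
    (contDiff_fun_id : ContDiff ℝ i fun p : Space × ℝ => p).contDiffAt
    ((ContinuousLinearMap.contDiff (ContinuousLinearMap.inr ℝ Space ℝ)).comp hfst).contDiffAt]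
  refine (norm_add_le _ _).trans (add_le_add_right ?_ _)
  refine ((ContinuousLinearMap.inr ℝ Space ℝ).norm_iteratedFDeriv_comp_left
    hfst.contDiffAt le_rfl).trans ?_
  refine (mul_le_of_le_one_left (norm_nonneg _)
    (ContinuousLinearMap.norm_inr_le_one ℝ Space ℝ)).trans ?_
  rw [ContinuousLinearMap.iteratedFDeriv_comp_right _ hu' _ le_rfl]
  refine (ContinuousMultilinearMap.norm_compContinuousLinearMap_le _ _).trans ?_
  refine mul_le_of_le_one_right (norm_nonneg _) ?_
  exact Finset.prod_le_one (fun _ _ => norm_nonneg _)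
    fun _ _ => ContinuousLinearMap.norm_fst_le ℝ Space ℝ

theorem norm_iteratedFDeriv_graphShear_le_of_two_le {u : Space → ℝ}
    (hu : ContDiff ℝ (⊤ : ℕ∞) u) {i : ℕ} (hi : 2 ≤ i) (p : Space × ℝ) :
    ‖iteratedFDeriv ℝ i (graphShear u) p‖ ≤ ‖iteratedFDeriv ℝ i u p.1‖ := by
  refine (norm_iteratedFDeriv_graphShear_le hu i p).trans_eq ?_
  obtain ⟨n, rfl⟩ := Nat.exists_eq_add_of_le' hi
  have hid : fderiv ℝ (fun p : Space × ℝ => p) = fun _ => ContinuousLinearMap.id ℝ _ :=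
    funext fun _ => fderiv_fun_id
  rw [← norm_iteratedFDeriv_fderiv, hid, iteratedFDeriv_succ_const]
  simp

theorem norm_iteratedFDeriv_graphShear_le_one_add {u : Space → ℝ}
    (hu : ContDiff ℝ (⊤ : ℕ∞) u) (p : Space × ℝ) :
    ‖iteratedFDeriv ℝ 1 (graphShear u) p‖ ≤ 1 + ‖iteratedFDeriv ℝ 1 u p.1‖ := by
  refine (norm_iteratedFDeriv_graphShear_le hu 1 p).trans (add_le_add_left ?_ _)
  rw [norm_iteratedFDeriv_one, fderiv_fun_id]
  exact ContinuousLinearMap.norm_id_le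

theorem OrderedFinpartition.sum_partSize {n : ℕ} (c : OrderedFinpartition n) :
    ∑ j, c.partSize j = n := by
  have := c.sum_sigma_eq_sum (fun _ => 1)
  simpa using this

theorem pow_eq_pow_length_mul_prod {n : ℕ} (c : OrderedFinpartition n) (σ : ℝ) :
    σ ^ n = σ ^ c.length * ∏ j, σ ^ (c.partSize j - 1) := by
  rw [Finset.prod_pow_eq_pow_sum, ← pow_add]
  congr 1
  have h : ∑ j, (c.partSize j - 1 + 1) = n :=
    (Finset.sum_congr rfl fun j _ => Nat.sub_add_cancel (c.partSize_pos j)).trans c.sum_partSize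
  rw [Finset.sum_add_distrib] at h
  simp at h
  omega

/-- Squared Faà di Bruno bound for one partition, with at most one part of size at least `s`. -/
theorem partition_term_sq_le {k s s' : ℕ} (hs : 3 ≤ s) (hk : k ≤ s + 1) (hks : k ≤ s')
    (c : OrderedFinpartition k) {M : ℝ} (hM : 1 ≤ M) {d e B : ℕ → ℝ} (hd0 : ∀ i, 0 ≤ d i)
    (hdM : ∀ i, 1 ≤ i → i < s → d i ≤ M) (hde : ∀ i, s ≤ i → d i ≤ e i) :
    (B c.length * ∏ j, d (c.partSize j)) ^ 2 ≤
      M ^ (2 * k) * (∑ m ∈ Finset.range (k + 1), B m ^ 2 +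
        ∑ m ∈ Finset.range (s' - 1), (e s ^ 2 + e (s + 1) ^ 2) * B m ^ 2) := by
  have hlen : c.length ≤ k := c.length_le
  have hM0 : 0 ≤ M := by linarith
  have hsum2 : ∀ m ∈ Finset.range (s' - 1), 0 ≤ (e s ^ 2 + e (s + 1) ^ 2) * B m ^ 2 :=
    fun m _ => by positivity
  have hsum1 : ∀ m ∈ Finset.range (k + 1), 0 ≤ B m ^ 2 := fun m _ => by positivity
  by_cases hall : ∀ j, c.partSize j < s
  · have hp : ∏ j, d (c.partSize j) ≤ M ^ k := by
      refine (Finset.prod_le_prod (fun j _ => hd0 _)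
        fun j _ => hdM _ (c.partSize_pos j) (hall j)).trans ?_
      rw [Finset.prod_const, Finset.card_univ, Fintype.card_fin]
      exact pow_le_pow_right₀ hM hlen
    have hp0 : 0 ≤ ∏ j, d (c.partSize j) := Finset.prod_nonneg fun j _ => hd0 _
    have h1 : B c.length ^ 2 ≤ ∑ m ∈ Finset.range (k + 1), B m ^ 2 :=
      Finset.single_le_sum hsum1 (Finset.mem_range.2 (by omega))
    rw [mul_pow, mul_comm 2 k, pow_mul, mul_comm]
    refine mul_le_mul (pow_le_pow_left₀ hp0 hp 2) ?_ (by positivity) (by positivity)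
    exact h1.trans (le_add_of_nonneg_right (Finset.sum_nonneg hsum2))
  · push Not at hall
    obtain ⟨j₀, hj₀⟩ := hall
    have hsum := c.sum_partSize
    rw [← Finset.add_sum_erase _ _ (Finset.mem_univ j₀)] at hsum
    have hcard : (Finset.univ.erase j₀).card = c.length - 1 := by
      rw [Finset.card_erase_of_mem (Finset.mem_univ _), Finset.card_univ, Fintype.card_fin]
    have hge : c.length - 1 ≤ ∑ j ∈ Finset.univ.erase j₀, c.partSize j := by
      rw [← hcard, Finset.card_eq_sum_ones]
      exact Finset.sum_le_sum fun j _ => c.partSize_pos j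
    have hp : ∏ j ∈ Finset.univ.erase j₀, d (c.partSize j) ≤ M ^ k := by
      refine (Finset.prod_le_prod (fun j _ => hd0 _) fun j hj =>
        hdM _ (c.partSize_pos j) ?_).trans ?_
      · have := Finset.single_le_sum (f := fun j => c.partSize j) (fun j _ => Nat.zero_le _) hj
        omega
      · rw [Finset.prod_const, hcard]
        exact pow_le_pow_right₀ hM (by omega)
    have hp0 : 0 ≤ ∏ j ∈ Finset.univ.erase j₀, d (c.partSize j) :=
      Finset.prod_nonneg fun j _ => hd0 _
    have he : d (c.partSize j₀) ^ 2 ≤ e s ^ 2 + e (s + 1) ^ 2 := by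
      have h1 := pow_le_pow_left₀ (hd0 _) (hde _ hj₀) 2
      rcases (by omega : c.partSize j₀ = s ∨ c.partSize j₀ = s + 1) with h | h <;>
        rw [h] at h1 ⊢ <;> nlinarith [sq_nonneg (e s), sq_nonneg (e (s + 1))]
    have h1 : (e s ^ 2 + e (s + 1) ^ 2) * B c.length ^ 2 ≤
        ∑ m ∈ Finset.range (s' - 1), (e s ^ 2 + e (s + 1) ^ 2) * B m ^ 2 :=
      Finset.single_le_sum hsum2 (Finset.mem_range.2 (by omega))
    rw [← Finset.mul_prod_erase _ _ (Finset.mem_univ j₀)]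
    calc (B c.length * (d (c.partSize j₀) * ∏ j ∈ Finset.univ.erase j₀, d (c.partSize j))) ^ 2
        = (∏ j ∈ Finset.univ.erase j₀, d (c.partSize j)) ^ 2 *
            (d (c.partSize j₀) ^ 2 * B c.length ^ 2) := by ring
      _ ≤ (M ^ k) ^ 2 * ((e s ^ 2 + e (s + 1) ^ 2) * B c.length ^ 2) := by gcongr
      _ ≤ _ := by
        rw [← pow_mul, mul_comm k 2]
        gcongr
        exact h1.trans (le_add_of_nonneg_left (Finset.sum_nonneg hsum1))

/-- Pointwise weighted Faà di Bruno estimate for the composition with a graph shear. -/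
theorem iteratedFDeriv_comp_graphShear_sq_le {u : Space → ℝ} (hu : ContDiff ℝ (⊤ : ℕ∞) u)
    {f : Space × ℝ → ℝ} (hf : ContDiff ℝ (⊤ : ℕ∞) f) {k s s' : ℕ} (hs : 3 ≤ s)
    (hk : k ≤ s + 1) (hks : k ≤ s') {M : ℝ} (hM : 1 ≤ M) {σ : ℝ} (hσ : 0 ≤ σ) (p : Space × ℝ)
    (hu1 : ∀ i, i + 1 < s → 1 + σ ^ i * ‖iteratedFDeriv ℝ (i + 1) u p.1‖ ≤ M) :
    (σ ^ k * ‖iteratedFDeriv ℝ k (fun p => f (p.1, u p.1 + p.2)) p‖) ^ 2 ≤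
      Fintype.card (OrderedFinpartition k) * (Fintype.card (OrderedFinpartition k) *
        (M ^ (2 * k) * (∑ m ∈ Finset.range (k + 1),
          (σ ^ m * ‖iteratedFDeriv ℝ m f (graphShear u p)‖) ^ 2 +
        ∑ m ∈ Finset.range (s' - 1), ((σ ^ (s - 1) * ‖iteratedFDeriv ℝ s u p.1‖) ^ 2 +
            (σ ^ s * ‖iteratedFDeriv ℝ (s + 1) u p.1‖) ^ 2) *
          (σ ^ m * ‖iteratedFDeriv ℝ m f (graphShear u p)‖) ^ 2))) := by
  have hle : (k : WithTop ℕ∞) ≤ ((⊤ : ℕ∞) : WithTop ℕ∞) := WithTop.coe_le_coe.2 le_top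
  set d : ℕ → ℝ := fun i => σ ^ (i - 1) * ‖iteratedFDeriv ℝ i (graphShear u) p‖ with hd
  set e : ℕ → ℝ := fun i => σ ^ (i - 1) * ‖iteratedFDeriv ℝ i u p.1‖ with he
  set B : ℕ → ℝ := fun m => σ ^ m * ‖iteratedFDeriv ℝ m f (graphShear u p)‖ with hB
  have hd0 : ∀ i, 0 ≤ d i := fun i => by positivity
  have hdM : ∀ i, 1 ≤ i → i < s → d i ≤ M := by
    intro i hi his
    obtain ⟨i, rfl⟩ := Nat.exists_eq_add_of_le' hi
    refine le_trans ?_ (hu1 i his)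
    simp only [hd, Nat.add_sub_cancel]
    rcases Nat.eq_zero_or_pos i with rfl | hi0
    · simpa using norm_iteratedFDeriv_graphShear_le_one_add hu p
    · have h1 := mul_le_mul_of_nonneg_left
        (norm_iteratedFDeriv_graphShear_le_of_two_le hu (i := i + 1) (by omega) p)
        (pow_nonneg hσ i)
      linarith
  have hde : ∀ i, s ≤ i → d i ≤ e i := fun i hi => mul_le_mul_of_nonneg_left
    (norm_iteratedFDeriv_graphShear_le_of_two_le hu (by omega) p) (pow_nonneg hσ _)
  have hnorm : σ ^ k * ‖iteratedFDeriv ℝ k (fun p => f (p.1, u p.1 + p.2)) p‖ ≤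
      ∑ c : OrderedFinpartition k, B c.length * ∏ j, d (c.partSize j) := by
    have hcomp : (fun p : Space × ℝ => f (p.1, u p.1 + p.2)) = f ∘ graphShear u := rfl
    rw [hcomp, iteratedFDeriv_comp (hf.of_le hle).contDiffAt
      (contDiff_graphShear (hu.of_le hle)).contDiffAt le_rfl,
      FormalMultilinearSeries.taylorComp]
    refine (mul_le_mul_of_nonneg_left (norm_sum_le _ _) (pow_nonneg hσ k)).trans ?_
    rw [Finset.mul_sum]
    refine Finset.sum_le_sum fun c _ => ?_
    refine (mul_le_mul_of_nonneg_left (c.norm_compAlongOrderedFinpartition_le _ _)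
      (pow_nonneg hσ k)).trans_eq ?_
    simp only [hB, hd, ftaylorSeries]
    rw [Finset.prod_mul_distrib, pow_eq_pow_length_mul_prod c σ]
    ring
  refine (pow_le_pow_left₀ (by positivity) hnorm 2).trans (sq_sum_le_card_mul_sum_sq.trans ?_)
  rw [Finset.card_univ]
  refine mul_le_mul_of_nonneg_left ?_ (Nat.cast_nonneg _)
  refine (Finset.sum_le_card_nsmul _ _ _ fun c _ =>
    partition_term_sq_le hs hk hks c hM hd0 hdM hde (B := B)).trans_eq ?_
  rw [nsmul_eq_mul, Finset.card_univ]
  rfl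

theorem sqrt_pow_eq_rpow {q : ℝ} (hq : 0 ≤ q) (n : ℕ) : √q ^ n = q ^ ((n : ℝ) / 2) := by
  rw [Real.sqrt_eq_rpow, ← Real.rpow_natCast, ← Real.rpow_mul hq]
  ring_nf

theorem lintegral_le_sq_of_wSob_le {s : ℕ} {δ δ₀ : ℝ} (hδ : δ₀ ≤ δ) {v : Space → ℝ} {R : ENNReal}
    (h : wSob s δ v ≤ R) {k : ℕ} (hk : k ≤ s) :
    ∫⁻ x, ENNReal.ofReal ((1 + ‖x‖ ^ 2) ^ (δ₀ + (k : ℝ)) * ‖iteratedFDeriv ℝ k v x‖ ^ 2) ≤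
      R ^ 2 := by
  calc ∫⁻ x, ENNReal.ofReal ((1 + ‖x‖ ^ 2) ^ (δ₀ + (k : ℝ)) * ‖iteratedFDeriv ℝ k v x‖ ^ 2)
      ≤ ∫⁻ x, ENNReal.ofReal ((1 + ‖x‖ ^ 2) ^ (δ + (k : ℝ)) * ‖iteratedFDeriv ℝ k v x‖ ^ 2) := by
        refine lintegral_mono fun x => ENNReal.ofReal_le_ofReal ?_
        refine mul_le_mul_of_nonneg_right ?_ (sq_nonneg _)
        exact Real.rpow_le_rpow_of_exponent_le (by nlinarith [sq_nonneg ‖x‖]) (by linarith)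
    _ ≤ ∑ k ∈ Finset.range (s + 1), ∫⁻ x,
          ENNReal.ofReal ((1 + ‖x‖ ^ 2) ^ (δ + (k : ℝ)) * ‖iteratedFDeriv ℝ k v x‖ ^ 2) :=
        Finset.single_le_sum (f := fun k : ℕ => ∫⁻ x : Space,
          ENNReal.ofReal ((1 + ‖x‖ ^ 2) ^ (δ + (k : ℝ)) * ‖iteratedFDeriv ℝ k v x‖ ^ 2))
          (fun _ _ => zero_le) (Finset.mem_range.2 (by omega))
    _ = wSob s δ v ^ 2 := by
        rw [wSob, ← ENNReal.rpow_natCast, ← ENNReal.rpow_mul]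
        norm_num
    _ ≤ R ^ 2 := by gcongr

/-- Uniform bound for `1 + σ^i ‖D^{i+1}u‖`, `i + 1 < s`, when `‖u‖_{H_{s+1,-5/2}} ≤ R`. -/
noncomputable def slopeBound (s : ℕ) (R : ENNReal) : ℝ :=
  1 + √(sobolevConst (-5 / 2) s * (3 * R ^ 2)).toReal

theorem one_add_pow_mul_norm_iteratedFDeriv_le_slopeBound {s : ℕ} {u : Space → ℝ}
    (hu : ContDiff ℝ (⊤ : ℕ∞) u) {δ : ℝ} (hδ : -5 / 2 ≤ δ) {R : ENNReal} (hR : R ≠ ⊤)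
    (h : wSob (s + 1) δ u ≤ R) (x : Space) {i : ℕ} (hi : i + 1 < s) :
    1 + √(1 + ‖x‖ ^ 2) ^ i * ‖iteratedFDeriv ℝ (i + 1) u x‖ ≤ slopeBound s R := by
  have hq : 0 < 1 + ‖x‖ ^ 2 := by positivity
  have hσ : 0 < √(1 + ‖x‖ ^ 2) ^ 3 := by positivity
  have hsob := weighted_iteratedFDeriv_sq_le hu (ContinuousLinearMap.id ℝ Space)
    ContinuousLinearMap.norm_id_le 0 x (-5 / 2) hi.le
  simp only [ContinuousLinearMap.id_apply, add_zero] at hsob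
  have hsum : ∑ l ∈ Finset.range 3, ∫⁻ y in outerShell x,
      ENNReal.ofReal ((1 + ‖y‖ ^ 2) ^ (-5 / 2 + ((i + 1 + l : ℕ) : ℝ)) *
        ‖iteratedFDeriv ℝ (i + 1 + l) u y‖ ^ 2) ≤ 3 * R ^ 2 := by
    refine (Finset.sum_le_card_nsmul _ _ (R ^ 2) fun l hl => ?_).trans_eq (by simp)
    refine (setLIntegral_le_lintegral _ _).trans (lintegral_le_sq_of_wSob_le hδ h ?_)
    have := Finset.mem_range.1 hl
    omega
  have hweight : (√(1 + ‖x‖ ^ 2) ^ i * ‖iteratedFDeriv ℝ (i + 1) u x‖) ^ 2 =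
      √(1 + ‖x‖ ^ 2) ^ 3 * ((1 + ‖x‖ ^ 2) ^ (-5 / 2 + ((i + 1 : ℕ) : ℝ)) *
        ‖iteratedFDeriv ℝ (i + 1) u x‖ ^ 2) := by
    rw [mul_pow, ← mul_assoc, ← pow_mul, sqrt_pow_eq_rpow hq.le, sqrt_pow_eq_rpow hq.le,
      ← Real.rpow_add hq]
    congr 2
    push_cast
    ring
  have hfin : sobolevConst (-5 / 2) s * (3 * R ^ 2) ≠ ⊤ :=
    ENNReal.mul_ne_top (sobolevConst_ne_top _ _)
      (ENNReal.mul_ne_top (by norm_num) (ENNReal.pow_ne_top hR))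
  have hsq : ENNReal.ofReal ((√(1 + ‖x‖ ^ 2) ^ i * ‖iteratedFDeriv ℝ (i + 1) u x‖) ^ 2) ≤
      sobolevConst (-5 / 2) s * (3 * R ^ 2) := by
    rw [hweight, ENNReal.ofReal_mul hσ.le]
    calc _ ≤ ENNReal.ofReal (√(1 + ‖x‖ ^ 2) ^ 3) * (sobolevConst (-5 / 2) s *
          (ENNReal.ofReal ((√(1 + ‖x‖ ^ 2) ^ 3)⁻¹) * (3 * R ^ 2))) := by
          gcongr
          exact hsob.trans (by gcongr)
      _ = (ENNReal.ofReal (√(1 + ‖x‖ ^ 2) ^ 3) * ENNReal.ofReal ((√(1 + ‖x‖ ^ 2) ^ 3)⁻¹)) *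
          (sobolevConst (-5 / 2) s * (3 * R ^ 2)) := by ring
      _ = _ := by
          rw [← ENNReal.ofReal_mul hσ.le, mul_inv_cancel₀ hσ.ne', ENNReal.ofReal_one, one_mul]
  rw [slopeBound, add_le_add_iff_left]
  exact Real.le_sqrt_of_sq_le ((ENNReal.ofReal_le_iff_le_toReal hfin).1 hsq)

theorem measurableSet_boostRegion (θ : ℝ) : MeasurableSet (boostRegion θ) :=
  measurableSet_le (f := fun p : Space × ℝ => |p.2|)
    (g := fun p : Space × ℝ => θ * √(1 + ‖p.1‖ ^ 2)) (by fun_prop) (by fun_prop)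

theorem mapsTo_graphShear_boostRegion {u : Space → ℝ} {θ κ : ℝ} (hθ : 0 ≤ θ) (hκ : -1 < κ)
    (hu : ∀ x, |u x| ≤ (θ / 2) * √(1 + ‖x‖ ^ 2) ^ (-κ)) :
    Set.MapsTo (graphShear u) (boostRegion (θ / 2)) (boostRegion θ) := by
  intro p hp
  have hσ : 1 ≤ √(1 + ‖p.1‖ ^ 2) := Real.one_le_sqrt.2 (by nlinarith [sq_nonneg ‖p.1‖])
  have h1 : √(1 + ‖p.1‖ ^ 2) ^ (-κ) ≤ √(1 + ‖p.1‖ ^ 2) := by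
    simpa using Real.rpow_le_rpow_of_exponent_le hσ (by linarith : -κ ≤ 1)
  have h2 := mul_le_mul_of_nonneg_left h1 (by linarith : 0 ≤ θ / 2)
  have hp' : |p.2| ≤ θ / 2 * √(1 + ‖p.1‖ ^ 2) := hp
  change |u p.1 + p.2| ≤ θ * √(1 + ‖p.1‖ ^ 2)
  linarith [abs_add_le (u p.1) p.2, hu p.1]

theorem setLIntegral_graphShear_le {u : Space → ℝ} (hu : Measurable u)
    {U V : Set (Space × ℝ)} (hV : MeasurableSet V) (hUV : Set.MapsTo (graphShear u) U V)
    {h : Space → ENNReal} (hh : Measurable h) {J : Space × ℝ → ENNReal} (hJ : Measurable J) :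
    ∫⁻ p in U, h p.1 * J (graphShear u p) ≤ ∫⁻ x, h x * ∫⁻ t, V.indicator J (x, t) := by
  have hG : Measurable (graphShear u) := by
    unfold graphShear
    fun_prop
  have hJV : Measurable (V.indicator J) := hJ.indicator hV
  calc ∫⁻ p in U, h p.1 * J (graphShear u p)
      ≤ ∫⁻ p in U, h p.1 * V.indicator J (graphShear u p) := by
        refine setLIntegral_mono ((hh.comp measurable_fst).mul (hJV.comp hG)) fun p hp => ?_
        rw [Set.indicator_of_mem (hUV hp)]
    _ ≤ ∫⁻ p, h p.1 * V.indicator J (graphShear u p) := setLIntegral_le_lintegral _ _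
    _ = ∫⁻ x, ∫⁻ t, h x * V.indicator J (x, u x + t) :=
        lintegral_prod _ ((hh.comp measurable_fst).mul (hJV.comp hG)).aemeasurable
    _ = ∫⁻ x, h x * ∫⁻ t, V.indicator J (x, t) := by
        refine lintegral_congr fun x => ?_
        rw [lintegral_const_mul (h x) (f := fun t => V.indicator J (x, u x + t))
          (hJV.comp (by fun_prop)),
          lintegral_add_left_eq_self (fun t => V.indicator J (x, t))]

/-- The density of the order `m` part of the squared weighted norm on `ℝ³ × ℝ`. -/
noncomputable def sobDensity (δ : ℝ) (f : Space × ℝ → ℝ) (m : ℕ) (p : Space × ℝ) : ENNReal :=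
  ENNReal.ofReal ((1 + ‖p.1‖ ^ 2) ^ (δ + (m : ℝ)) * ‖iteratedFDeriv ℝ m f p‖ ^ 2)

theorem measurable_sobDensity (δ : ℝ) {f : Space × ℝ → ℝ} (hf : ContDiff ℝ (⊤ : ℕ∞) f) (m : ℕ) :
    Measurable (sobDensity δ f m) := by
  have h := (hf.continuous_iteratedFDeriv (m := m) (WithTop.coe_le_coe.2 le_top)).norm.measurable
  unfold sobDensity
  fun_prop

/-- The derivatives of `f` of order at most `n - 2` are controlled on time slices,
by Sobolev embedding in space. -/
theorem lintegral_slice_sobDensity_le {f : Space × ℝ → ℝ} (hf : ContDiff ℝ (⊤ : ℕ∞) f) {θ : ℝ}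
    (hθ : 0 ≤ θ) (δ : ℝ) {m n : ℕ} (hmn : m + 2 ≤ n) (x : Space) :
    ∫⁻ t, (boostRegion θ).indicator (sobDensity δ f m) (x, t) ≤
      sobolevConst δ n * (ENNReal.ofReal ((√(1 + ‖x‖ ^ 2) ^ 3)⁻¹) *
        (3 * ∑ k ∈ Finset.range (n + 1), ∫⁻ p in boostRegion θ, sobDensity δ f k p)) := by
  have hmeas : ∀ k, Measurable ((boostRegion θ).indicator (sobDensity δ f k)) := fun k =>
    (measurable_sobDensity δ hf k).indicator (measurableSet_boostRegion θ)
  have hin : ∀ k, Measurable fun t =>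
      ∫⁻ y, (boostRegion θ).indicator (sobDensity δ f k) (y, t) := fun k =>
    (hmeas k).lintegral_prod_left'
  have hpt : ∀ t, (boostRegion θ).indicator (sobDensity δ f m) (x, t) ≤
      sobolevConst δ n * (ENNReal.ofReal ((√(1 + ‖x‖ ^ 2) ^ 3)⁻¹) *
        ∑ l ∈ Finset.range 3, ∫⁻ y, (boostRegion θ).indicator (sobDensity δ f (m + l)) (y, t)) := by
    intro t
    by_cases hx : (x, t) ∈ boostRegion θ
    · rw [Set.indicator_of_mem hx]
      have h := weighted_iteratedFDeriv_sq_le hf (ContinuousLinearMap.inl ℝ Space ℝ)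
        (ContinuousLinearMap.norm_inl_le_one ℝ Space ℝ) (0, t) x δ (by omega : m ≤ n)
      simp only [ContinuousLinearMap.inl_apply, Prod.mk_add_mk, add_zero, zero_add] at h
      refine h.trans ?_
      refine mul_le_mul' le_rfl (mul_le_mul' le_rfl (Finset.sum_le_sum fun l _ => ?_))
      refine le_trans ?_ (setLIntegral_le_lintegral (outerShell x) _)
      refine setLIntegral_mono ((hmeas _).comp (by fun_prop)) fun y hy => ?_
      have hyt : (y, t) ∈ boostRegion θ := by
        have hx' : |t| ≤ θ * √(1 + ‖x‖ ^ 2) := hx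
        have hxy : ‖x‖ ≤ ‖y‖ := hy.1
        change |t| ≤ θ * √(1 + ‖y‖ ^ 2)
        exact hx'.trans (by gcongr)
      rw [Set.indicator_of_mem hyt]
      rfl
    · rw [Set.indicator_of_notMem hx]
      exact zero_le
  refine (lintegral_mono hpt).trans ?_
  rw [lintegral_const_mul' _ _ (sobolevConst_ne_top _ _),
    lintegral_const_mul' _ _ ENNReal.ofReal_ne_top, lintegral_finsetSum _ fun l _ => hin _]
  gcongr
  refine (Finset.sum_le_card_nsmul _ _
    (∑ k ∈ Finset.range (n + 1), ∫⁻ p in boostRegion θ, sobDensity δ f k p)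
    fun l hl => ?_).trans_eq (by rw [Finset.card_range, nsmul_eq_mul]; norm_num)
  rw [← lintegral_prod_symm _ (hmeas _).aemeasurable,
    lintegral_indicator (measurableSet_boostRegion θ)]
  have := Finset.mem_range.1 hl
  exact Finset.single_le_sum (f := fun k => ∫⁻ p in boostRegion θ, sobDensity δ f k p)
    (fun _ _ => zero_le) (Finset.mem_range.2 (by omega))

/-- The squared weighted size of the two top-order derivatives of `u`. -/
noncomputable def topDensity (s : ℕ) (u : Space → ℝ) (x : Space) : ℝ :=
  (√(1 + ‖x‖ ^ 2) ^ (s - 1) * ‖iteratedFDeriv ℝ s u x‖) ^ 2 +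
    (√(1 + ‖x‖ ^ 2) ^ s * ‖iteratedFDeriv ℝ (s + 1) u x‖) ^ 2

theorem measurable_topDensity (s : ℕ) {u : Space → ℝ} (hu : ContDiff ℝ (⊤ : ℕ∞) u) :
    Measurable (topDensity s u) := by
  have h (m : ℕ) := (hu.continuous_iteratedFDeriv (m := m)
    (WithTop.coe_le_coe.2 le_top)).norm.measurable
  have h1 := h s
  have h2 := h (s + 1)
  unfold topDensity
  fun_prop

theorem lintegral_topDensity_le {s : ℕ} (hs : 1 ≤ s) {u : Space → ℝ}
    (hu : ContDiff ℝ (⊤ : ℕ∞) u) {δ : ℝ} (hδ : -5 / 2 ≤ δ) {R : ENNReal}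
    (h : wSob (s + 1) δ u ≤ R) :
    ∫⁻ x, ENNReal.ofReal (topDensity s u x) * ENNReal.ofReal ((√(1 + ‖x‖ ^ 2) ^ 3)⁻¹) ≤
      2 * R ^ 2 := by
  have hmeas : Measurable fun x : Space => ENNReal.ofReal
      ((1 + ‖x‖ ^ 2) ^ (-5 / 2 + (s : ℝ)) * ‖iteratedFDeriv ℝ s u x‖ ^ 2) := by
    have := (hu.continuous_iteratedFDeriv (m := s)
      (WithTop.coe_le_coe.2 le_top)).norm.measurable
    fun_prop
  have hpt : ∀ x : Space,
      ENNReal.ofReal (topDensity s u x) * ENNReal.ofReal ((√(1 + ‖x‖ ^ 2) ^ 3)⁻¹) =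
        ENNReal.ofReal ((1 + ‖x‖ ^ 2) ^ (-5 / 2 + (s : ℝ)) * ‖iteratedFDeriv ℝ s u x‖ ^ 2) +
        ENNReal.ofReal ((1 + ‖x‖ ^ 2) ^ (-5 / 2 + ((s + 1 : ℕ) : ℝ)) *
          ‖iteratedFDeriv ℝ (s + 1) u x‖ ^ 2) := by
    intro x
    have hq : 0 < 1 + ‖x‖ ^ 2 := by positivity
    have hw : ∀ n : ℕ, (√(1 + ‖x‖ ^ 2) ^ n) ^ 2 * (√(1 + ‖x‖ ^ 2) ^ 3)⁻¹ =
        (1 + ‖x‖ ^ 2) ^ (-5 / 2 + ((n + 1 : ℕ) : ℝ)) := by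
      intro n
      rw [← pow_mul, sqrt_pow_eq_rpow hq.le, sqrt_pow_eq_rpow hq.le, ← Real.rpow_neg hq.le,
        ← Real.rpow_add hq]
      congr 1
      push_cast
      ring
    have h1 := hw (s - 1)
    rw [Nat.sub_add_cancel hs] at h1
    rw [← ENNReal.ofReal_mul (by unfold topDensity; positivity),
      ← ENNReal.ofReal_add (by positivity) (by positivity), ← h1, ← hw s, topDensity]
    ring_nf
  rw [lintegral_congr hpt, lintegral_add_left hmeas, two_mul]
  exact add_le_add (lintegral_le_sq_of_wSob_le hδ h (by omega))
    (lintegral_le_sq_of_wSob_le hδ h le_rfl)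

/-- The constant in the squared estimate of the order `k` part. -/
noncomputable def graphCompConst (s k : ℕ) (R : ENNReal) : ENNReal :=
  ENNReal.ofReal (Fintype.card (OrderedFinpartition k) * (Fintype.card (OrderedFinpartition k) *
    slopeBound s R ^ (2 * k)))

theorem one_le_slopeBound (s : ℕ) (R : ENNReal) : 1 ≤ slopeBound s R :=
  le_add_of_nonneg_right (Real.sqrt_nonneg _)

theorem sobDensity_comp_graphShear_le {u : Space → ℝ} (hu : ContDiff ℝ (⊤ : ℕ∞) u)
    {f : Space × ℝ → ℝ} (hf : ContDiff ℝ (⊤ : ℕ∞) f) {k s s' : ℕ} (hs : 3 ≤ s)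
    (hk : k ≤ s + 1) (hks : k ≤ s') {δ : ℝ} (hδ : -5 / 2 ≤ δ) {R : ENNReal} (hR : R ≠ ⊤)
    (h : wSob (s + 1) δ u ≤ R) (δ' : ℝ) (p : Space × ℝ) :
    sobDensity δ' (fun p => f (p.1, u p.1 + p.2)) k p ≤
      graphCompConst s k R * (∑ m ∈ Finset.range (k + 1), sobDensity δ' f m (graphShear u p) +
        ∑ m ∈ Finset.range (s' - 1),
          ENNReal.ofReal (topDensity s u p.1) * sobDensity δ' f m (graphShear u p)) := by
  have hq : 0 < 1 + ‖p.1‖ ^ 2 := by positivity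
  have hM := one_le_slopeBound s R
  have hE : 0 ≤ topDensity s u p.1 := by unfold topDensity; positivity
  have hw : ∀ (m : ℕ) (a : ℝ), (1 + ‖p.1‖ ^ 2) ^ (δ' + (m : ℝ)) * a ^ 2 =
      (1 + ‖p.1‖ ^ 2) ^ δ' * (√(1 + ‖p.1‖ ^ 2) ^ m * a) ^ 2 := by
    intro m a
    rw [mul_pow, ← pow_mul, mul_comm m 2, pow_mul, Real.sq_sqrt hq.le, Real.rpow_add hq,
      Real.rpow_natCast, mul_assoc]
  have hsob : ∀ m, sobDensity δ' f m (graphShear u p) =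
      ENNReal.ofReal ((1 + ‖p.1‖ ^ 2) ^ δ' *
        (√(1 + ‖p.1‖ ^ 2) ^ m * ‖iteratedFDeriv ℝ m f (graphShear u p)‖) ^ 2) :=
    fun m => congrArg ENNReal.ofReal (hw m _)
  have hmain := mul_le_mul_of_nonneg_left
    (iteratedFDeriv_comp_graphShear_sq_le hu hf hs hk hks hM
      (Real.sqrt_nonneg (1 + ‖p.1‖ ^ 2)) p
      fun i hi => one_add_pow_mul_norm_iteratedFDeriv_le_slopeBound hu hδ hR h p.1 hi)
    (Real.rpow_nonneg hq.le δ')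
  rw [← hw] at hmain
  refine (ENNReal.ofReal_le_ofReal hmain).trans_eq ?_
  simp only [hsob, ← ENNReal.ofReal_mul hE]
  rw [← ENNReal.ofReal_sum_of_nonneg fun m _ => by positivity,
    ← ENNReal.ofReal_sum_of_nonneg fun m _ => by positivity,
    ← ENNReal.ofReal_add (Finset.sum_nonneg fun m _ => by positivity)
      (Finset.sum_nonneg fun m _ => by positivity), graphCompConst,
    ← ENNReal.ofReal_mul (by positivity)]
  congr 1
  simp only [topDensity, mul_left_comm _ ((1 + ‖p.1‖ ^ 2) ^ δ'), ← Finset.mul_sum]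
  ring

theorem setLIntegral_sobDensity_comp_graphShear_le {u : Space → ℝ} (hu : ContDiff ℝ (⊤ : ℕ∞) u)
    {f : Space × ℝ → ℝ} (hf : ContDiff ℝ (⊤ : ℕ∞) f) {k s s' : ℕ} (hs : 3 ≤ s)
    (hk : k ≤ s + 1) (hks : k ≤ s') {δ : ℝ} (hδ : -5 / 2 ≤ δ) {R : ENNReal} (hR : R ≠ ⊤)
    (h : wSob (s + 1) δ u ≤ R) (δ' : ℝ) {θ : ℝ} (hθ : 0 ≤ θ)
    (hmaps : Set.MapsTo (graphShear u) (boostRegion (θ / 2)) (boostRegion θ)) :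
    ∫⁻ p in boostRegion (θ / 2), sobDensity δ' (fun p => f (p.1, u p.1 + p.2)) k p ≤
      graphCompConst s k R * ((k + 1 : ℕ) + (s' - 1 : ℕ) * (sobolevConst δ' s' * (6 * R ^ 2))) *
        ∑ k ∈ Finset.range (s' + 1), ∫⁻ p in boostRegion θ, sobDensity δ' f k p := by
  set N := ∑ k ∈ Finset.range (s' + 1), ∫⁻ p in boostRegion θ, sobDensity δ' f k p with hN
  have hJ := measurable_sobDensity δ' hf
  have hG : Measurable (graphShear u) := (contDiff_graphShear hu).continuous.measurable
  have hE : Measurable fun x => ENNReal.ofReal (topDensity s u x) :=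
    (measurable_topDensity s hu).ennreal_ofReal
  have hm1 : ∀ m, Measurable fun p => sobDensity δ' f m (graphShear u p) :=
    fun m => (hJ m).comp hG
  have hm2 : ∀ m, Measurable fun p : Space × ℝ =>
      ENNReal.ofReal (topDensity s u p.1) * sobDensity δ' f m (graphShear u p) :=
    fun m => (hE.comp measurable_fst).mul (hm1 m)
  have hlow : ∀ m ∈ Finset.range (k + 1),
      ∫⁻ p in boostRegion (θ / 2), sobDensity δ' f m (graphShear u p) ≤ N := by
    intro m hm
    have hmk := Finset.mem_range.1 hm
    have h1 := setLIntegral_graphShear_le hu.continuous.measurable (measurableSet_boostRegion θ)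
      hmaps (h := fun _ => 1) measurable_const (hJ m)
    simp only [one_mul] at h1
    refine h1.trans ?_
    rw [← lintegral_prod _ ((hJ m).indicator (measurableSet_boostRegion θ)).aemeasurable,
      lintegral_indicator (measurableSet_boostRegion θ)]
    exact Finset.single_le_sum (f := fun k => ∫⁻ p in boostRegion θ, sobDensity δ' f k p)
      (fun _ _ => zero_le) (Finset.mem_range.2 (by omega))
  have hhigh : ∀ m ∈ Finset.range (s' - 1), ∫⁻ p in boostRegion (θ / 2),
      ENNReal.ofReal (topDensity s u p.1) * sobDensity δ' f m (graphShear u p) ≤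
        sobolevConst δ' s' * (6 * R ^ 2) * N := by
    intro m hm
    have hms := Finset.mem_range.1 hm
    refine (setLIntegral_graphShear_le hu.continuous.measurable (measurableSet_boostRegion θ)
      hmaps hE (hJ m)).trans ?_
    calc ∫⁻ x, ENNReal.ofReal (topDensity s u x) *
          ∫⁻ t, (boostRegion θ).indicator (sobDensity δ' f m) (x, t)
        ≤ ∫⁻ x, ENNReal.ofReal (topDensity s u x) * (sobolevConst δ' s' *
            (ENNReal.ofReal ((√(1 + ‖x‖ ^ 2) ^ 3)⁻¹) * (3 * N))) :=
          lintegral_mono fun x => mul_le_mul' le_rfl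
            (lintegral_slice_sobDensity_le hf hθ δ' (by omega) x)
      _ = ∫⁻ x, (ENNReal.ofReal (topDensity s u x) *
            ENNReal.ofReal ((√(1 + ‖x‖ ^ 2) ^ 3)⁻¹)) * (sobolevConst δ' s' * (3 * N)) :=
          lintegral_congr fun x => by ring
      _ = (∫⁻ x, ENNReal.ofReal (topDensity s u x) *
            ENNReal.ofReal ((√(1 + ‖x‖ ^ 2) ^ 3)⁻¹)) * (sobolevConst δ' s' * (3 * N)) :=
          lintegral_mul_const _ (hE.mul (by fun_prop))
      _ ≤ (2 * R ^ 2) * (sobolevConst δ' s' * (3 * N)) :=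
          mul_le_mul' (lintegral_topDensity_le (by omega) hu hδ h) le_rfl
      _ = _ := by ring
  calc ∫⁻ p in boostRegion (θ / 2), sobDensity δ' (fun p => f (p.1, u p.1 + p.2)) k p
      ≤ ∫⁻ p in boostRegion (θ / 2), graphCompConst s k R *
          (∑ m ∈ Finset.range (k + 1), sobDensity δ' f m (graphShear u p) +
            ∑ m ∈ Finset.range (s' - 1),
              ENNReal.ofReal (topDensity s u p.1) * sobDensity δ' f m (graphShear u p)) :=
        lintegral_mono fun p => sobDensity_comp_graphShear_le hu hf hs hk hks hδ hR h δ' p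
    _ = graphCompConst s k R * ((∑ m ∈ Finset.range (k + 1),
          ∫⁻ p in boostRegion (θ / 2), sobDensity δ' f m (graphShear u p)) +
        ∑ m ∈ Finset.range (s' - 1), ∫⁻ p in boostRegion (θ / 2),
          ENNReal.ofReal (topDensity s u p.1) * sobDensity δ' f m (graphShear u p)) := by
        rw [lintegral_const_mul' (graphCompConst s k R) _ ENNReal.ofReal_ne_top,
          lintegral_add_left (Finset.measurable_fun_sum _ fun m _ => hm1 m),
          lintegral_finsetSum _ fun m _ => hm1 m, lintegral_finsetSum _ fun m _ => hm2 m]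
    _ ≤ graphCompConst s k R *
          ((k + 1) • N + (s' - 1) • (sobolevConst δ' s' * (6 * R ^ 2) * N)) := by
        gcongr
        · simpa using Finset.sum_le_card_nsmul _ _ _ hlow
        · simpa using Finset.sum_le_card_nsmul _ _ _ hhigh
    _ = _ := by
        simp only [nsmul_eq_mul]
        ring

/-- **Composition with a graph map in weighted Sobolev spaces**: for `s₁ ≥ 3`, `δ₁ > −2`,
`θ ∈ (0,1]`, `−1 < κ < δ₁ + 1` and `ρ > 0`, for each `s′ ≤ s₁+1` and `δ′ ∈ ℝ` there is a
constant `C = C(s₁, δ₁, s′, δ′, θ, κ, ρ)` such that: for every smooth `u : ℝ³ → ℝ` with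
`‖u‖_{H_{s₁+1, δ₁−1/2}(ℝ³)} ≤ ρ` and `|u(x)| ≤ (θ/2)σ(x)^{−κ}`, and every smooth `f` on
`Ω_θ` with finite `H_{s′,δ′}(Ω_θ)`-norm, the function `f̃(x,t) := f(x, u(x)+t)` satisfies
`‖f̃‖_{H_{s′,δ′}(Ω_{θ/2})} ≤ C ‖f‖_{H_{s′,δ′}(Ω_θ)}`. -/
theorem weighted_sobolev_graph_composition
    (s₁ : ℕ) (hs₁ : 3 ≤ s₁) (δ₁ : ℝ) (hδ₁ : -2 < δ₁)
    (θ : ℝ) (hθ : θ ∈ Set.Ioc (0 : ℝ) 1)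
    (κ : ℝ) (hκ₁ : -1 < κ) (hκ₂ : κ < δ₁ + 1) (ρ : ℝ) (hρ : 0 < ρ) :
    ∀ s' : ℕ, s' ≤ s₁ + 1 → ∀ δ' : ℝ,
      ∃ C : ℝ, 0 < C ∧
        ∀ u : EuclideanSpace ℝ (Fin 3) → ℝ, ContDiff ℝ (⊤ : ℕ∞) u →
          wSob (s₁ + 1) (δ₁ - 1/2) u ≤ ENNReal.ofReal ρ →
          (∀ x, |u x| ≤ (θ / 2) * Real.sqrt (1 + ‖x‖ ^ 2) ^ (-κ)) →
          ∀ f : EuclideanSpace ℝ (Fin 3) × ℝ → ℝ, ContDiff ℝ (⊤ : ℕ∞) f →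
            wSobOn s' δ' (boostRegion θ) f < ⊤ →
            wSobOn s' δ' (boostRegion (θ / 2)) (fun p => f (p.1, u p.1 + p.2))
              ≤ ENNReal.ofReal C * wSobOn s' δ' (boostRegion θ) f := by
  intro s' hs' δ'
  set R := ENNReal.ofReal ρ
  have hR : R ≠ ⊤ := ENNReal.ofReal_ne_top
  set K : ENNReal := ∑ k ∈ Finset.range (s' + 1), graphCompConst s₁ k R *
    ((k + 1 : ℕ) + (s' - 1 : ℕ) * (sobolevConst δ' s' * (6 * R ^ 2))) with hK
  have hKtop : K ≠ ⊤ := by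
    refine (ENNReal.sum_lt_top.2 fun k _ => ?_).ne
    refine ENNReal.mul_lt_top ENNReal.ofReal_lt_top (ENNReal.add_lt_top.2
      ⟨ENNReal.natCast_lt_top _, ENNReal.mul_lt_top (ENNReal.natCast_lt_top _) ?_⟩)
    exact ENNReal.mul_lt_top (sobolevConst_ne_top _ _).lt_top
      (ENNReal.mul_lt_top (by norm_num) (ENNReal.pow_lt_top hR.lt_top))
  have hKhalf : K ^ (1 / 2 : ℝ) ≠ ⊤ := ENNReal.rpow_ne_top_of_nonneg (by norm_num) hKtop
  refine ⟨(K ^ (1 / 2 : ℝ)).toReal + 1, by positivity, fun u hu hunorm husmall f hf _ => ?_⟩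
  have hmaps := mapsTo_graphShear_boostRegion hθ.1.le hκ₁ husmall
  calc wSobOn s' δ' (boostRegion (θ / 2)) (fun p => f (p.1, u p.1 + p.2))
      ≤ (K * ∑ k ∈ Finset.range (s' + 1), ∫⁻ p in boostRegion θ, sobDensity δ' f k p) ^
          (1 / 2 : ℝ) := by
        refine ENNReal.rpow_le_rpow ?_ (by norm_num)
        rw [hK, Finset.sum_mul]
        refine Finset.sum_le_sum fun k hk => ?_
        have hk' := Finset.mem_range.1 hk
        exact setLIntegral_sobDensity_comp_graphShear_le hu hf hs₁ (by omega) (by omega)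
          (by linarith) hR hunorm δ' hθ.1.le hmaps
    _ = K ^ (1 / 2 : ℝ) * wSobOn s' δ' (boostRegion θ) f :=
        ENNReal.mul_rpow_of_nonneg _ _ (by norm_num)
    _ ≤ _ := by
        gcongr
        rw [← ENNReal.ofReal_toReal hKhalf]
        exact ENNReal.ofReal_le_ofReal (by simp)
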